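/- arXiv:1502.05910 — 3 statements merged into one kernel-verified Lean document; each statement's English description precedes it below -/
import Mathlib

section
/- Let C be a minor-closed class of finite simple graphs that contains the empty graph. Then for every k ≥ 0, the class of finite simple graphs whose elimination distance to C is at most k is minor-closed. -/
open SimpleGraph

/-- A class of simple graphs: a predicate on graphs over every vertex type. -/
abbrev GraphClass : Type 1 := ∀ (V : Type), SimpleGraph V → Prop

/-- A graph class is closed under isomorphism. -/
def IsoClosed (C : GraphClass) : Prop :=
  ∀ {V W : Type} (G : SimpleGraph V) (H : SimpleGraph W),
    Nonempty (G ≃g H) → C V G → C W H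

/-- A graph class contains only finite graphs. -/
def FiniteGraphClass (C : GraphClass) : Prop :=
  ∀ (V : Type) (G : SimpleGraph V), C V G → Finite V

/-- `H` is a minor of `G`: there is a family of pairwise disjoint nonempty
branch sets in `G`, each inducing a connected subgraph of `G`, such that every
edge of `H` is witnessed by an edge of `G` between the corresponding branch sets. -/
def IsMinor {V W : Type} (H : SimpleGraph V) (G : SimpleGraph W) : Prop :=
  ∃ T : V → Set W,
    (∀ v, (T v).Nonempty) ∧
    (Pairwise fun u v => Disjoint (T u) (T v)) ∧
    (∀ v, (G.induce (T v)).Connected) ∧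
    (∀ u v, H.Adj u v → ∃ u' ∈ T u, ∃ v' ∈ T v, G.Adj u' v')

/-- `H` is a proper minor of `G`: `H` is a minor of `G` but not conversely. -/
def IsProperMinor {V W : Type} (H : SimpleGraph V) (G : SimpleGraph W) : Prop :=
  IsMinor H G ∧ ¬ IsMinor G H

/-- A graph class is closed under taking minors. -/
def MinorClosed (C : GraphClass) : Prop :=
  ∀ (V W : Type) (H : SimpleGraph V) (G : SimpleGraph W),
    IsMinor H G → C W G → C V H

/-- The set `M(C)` of minimal excluded minors of `C`: graphs not in `C` all of
whose proper minors are in `C`. -/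
def MinExcludedMinor (C : GraphClass) : GraphClass := fun V G =>
  ¬ C V G ∧ ∀ (W : Type) (H : SimpleGraph W), IsProperMinor H G → C W H

/-- `EdLE C V G k` says that the elimination distance of `G` to `C` is at most
`k`: it is `0` if `G ∈ C`; for connected `G ∉ C` it is one more than the
minimum over vertices `v` of the elimination distance of `G ∖ v`; otherwise it
is the maximum of the elimination distances of the connected components. -/
inductive EdLE (C : GraphClass) : ∀ (V : Type), SimpleGraph V → ℕ → Prop
  | mem (V : Type) (G : SimpleGraph V) (k : ℕ) : C V G → EdLE C V G k
  | delete (V : Type) (G : SimpleGraph V) (k : ℕ) (v : V) :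
      ¬ C V G → G.Connected →
      EdLE C ↥({v}ᶜ : Set V) (G.induce {v}ᶜ) k → EdLE C V G (k + 1)
  | components (V : Type) (G : SimpleGraph V) (k : ℕ) :
      ¬ C V G → ¬ G.Connected →
      (∀ c : G.ConnectedComponent, EdLE C ↥c.supp (G.induce c.supp) k) →
      EdLE C V G k


lemma isMinor_restrict {V W : Type} {H : SimpleGraph V} {G : SimpleGraph W} (T : V → Set W)
    (h1 : ∀ v, (T v).Nonempty) (h2 : Pairwise fun u v => Disjoint (T u) (T v))
    (h3 : ∀ v, (G.induce (T v)).Connected)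
    (h4 : ∀ u v, H.Adj u v → ∃ u' ∈ T u, ∃ v' ∈ T v, G.Adj u' v')
    (S : Set W) (hS : ∀ v, T v ⊆ S) : IsMinor H (G.induce S) := by
  refine ⟨fun v => Subtype.val ⁻¹' T v, ?_, ?_, ?_, ?_⟩
  · intro v
    obtain ⟨x, hx⟩ := h1 v
    exact ⟨⟨x, hS v hx⟩, hx⟩
  · intro u v huv
    exact (h2 huv).preimage _
  · intro v
    let e : G.induce (T v) ≃g (G.induce S).induce (Subtype.val ⁻¹' T v) :=
      { toFun := fun x => ⟨⟨x.1, hS v x.2⟩, x.2⟩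
        invFun := fun x => ⟨x.1.1, x.2⟩
        left_inv := fun x => rfl
        right_inv := fun x => rfl
        map_rel_iff' := Iff.rfl }
    exact e.connected_iff.1 (h3 v)
  · intro u v huv
    obtain ⟨x, hx, y, hy, hxy⟩ := h4 u v huv
    exact ⟨⟨x, hS u hx⟩, hx, ⟨y, hS v hy⟩, hy, hxy⟩

lemma isMinor_induce {V W : Type} {H : SimpleGraph V} {G : SimpleGraph W} (h : IsMinor H G)
    (D : Set V) : IsMinor (H.induce D) G := by
  obtain ⟨T, h1, h2, h3, h4⟩ := h
  exact ⟨fun v => T v.1, fun v => h1 _, fun u v huv => h2 (fun h => huv (Subtype.ext h)),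
    fun v => h3 _, fun u v huv => h4 _ _ huv⟩

lemma isMinor_component {V W : Type} {H : SimpleGraph V} {G : SimpleGraph W} (h : IsMinor H G)
    (hH : H.Connected) : ∃ c : G.ConnectedComponent, IsMinor H (G.induce c.supp) := by
  obtain ⟨T, h1, h2, h3, h4⟩ := h
  have key : ∀ v, ∀ x ∈ T v, ∀ y ∈ T v, G.Reachable x y := by
    intro v x hx y hy
    exact ((h3 v).preconnected ⟨x, hx⟩ ⟨y, hy⟩).map (Embedding.induce (T v)).toHom
  have key2 : ∀ u v, H.Walk u v → ∀ x ∈ T u, ∀ y ∈ T v, G.Reachable x y := by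
    intro u v p
    induction p with
    | nil => exact key _
    | cons hadj p ih =>
      intro x hx y hy
      obtain ⟨a, ha, b, hb, hab⟩ := h4 _ _ hadj
      exact (key _ x hx a ha).trans (hab.reachable.trans (ih b hb y hy))
  obtain ⟨v0⟩ := hH.nonempty
  obtain ⟨x0, hx0⟩ := h1 v0
  refine ⟨G.connectedComponentMk x0, isMinor_restrict T h1 h2 h3 h4 _ ?_⟩
  intro v x hx
  obtain ⟨p⟩ := hH.preconnected v v0
  exact ConnectedComponent.sound (key2 _ _ p x hx x0 hx0)

lemma edLE_of_connected {C : GraphClass} {W : Type} {G : SimpleGraph W} {k : ℕ}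
    (hc : ∀ (V : Type) (H : SimpleGraph V), H.Connected → IsMinor H G → EdLE C V H k)
    (V : Type) (H : SimpleGraph V) (h : IsMinor H G) : EdLE C V H k := by
  by_cases hC : C V H
  · exact .mem _ _ _ hC
  by_cases hH : H.Connected
  · exact hc _ _ hH h
  exact .components _ _ _ hC hH fun c => hc _ _ c.connected_toSimpleGraph (isMinor_induce h _)

lemma isMinor_delete {V W : Type} {H : SimpleGraph V} {G : SimpleGraph W} (h : IsMinor H G)
    [Nonempty V] (w : W) : ∃ u : V, IsMinor (H.induce {u}ᶜ) (G.induce {w}ᶜ) := by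
  obtain ⟨T, h1, h2, h3, h4⟩ := h
  have hu : ∃ u, ∀ v, v ≠ u → w ∉ T v := by
    by_cases hw : ∃ u, w ∈ T u
    · obtain ⟨u, hu⟩ := hw
      exact ⟨u, fun v hv hwv => Set.disjoint_left.1 (h2 hv) hwv hu⟩
    · exact ⟨Classical.arbitrary V, fun v _ hv => hw ⟨v, hv⟩⟩
  obtain ⟨u, hu⟩ := hu
  refine ⟨u, isMinor_restrict (fun v => T v.1) (fun v => h1 _)
    (fun a b hab => h2 (fun h => hab (Subtype.ext h))) (fun v => h3 _)
    (fun a b hab => h4 _ _ hab) _ ?_⟩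
  rintro ⟨v, hv⟩ x hx rfl
  exact hu v hv hx

/-- If `C` is a minor-closed class of finite graphs containing the empty
graph, then for every `k` the class of finite graphs whose elimination
distance to `C` is at most `k` is minor-closed. -/
theorem minorClosed_eliminationDistance_le
    (C : GraphClass) (hfin : FiniteGraphClass C) (hminor : MinorClosed C)
    (hempty : C Empty ⊥) (k : ℕ) :
    ∀ (V W : Type) [Finite V] [Finite W] (H : SimpleGraph V) (G : SimpleGraph W),
      IsMinor H G → EdLE C W G k → EdLE C V H k := by
  intro V W _ _ H G hHG hG
  suffices ∀ (V : Type) (H : SimpleGraph V), IsMinor H G → EdLE C V H k from this V H hHG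
  clear hHG
  induction hG with
  | mem W G k hC => exact fun V H h => .mem _ _ _ (hminor _ _ _ _ h hC)
  | delete W G k w hC hconn hG ih =>
    refine edLE_of_connected fun V H hH h => ?_
    by_cases hCH : C V H
    · exact .mem _ _ _ hCH
    have := hH.nonempty
    obtain ⟨u, hu⟩ := isMinor_delete h w
    exact .delete _ _ _ u hCH hH (ih _ _ hu)
  | components W G k hC hconn hG ih =>
    refine edLE_of_connected fun V H hH h => ?_
    obtain ⟨c, hc⟩ := isMinor_component h hH
    exact ih c _ _ hc
end

section
/- Let G' be a connected finite simple graph and let H be a finite simple graph with at least one vertex. If H is a minor of G', then there exists a graph Ĥ in the connection closure of H such that Ĥ is a minor of G'. -/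
open SimpleGraph

/-- `Ĥ` belongs to the connection closure of `H`: `Ĥ` is minimal under the
subgraph relation among connected graphs on the vertex set of `H` whose
induced subgraph on the vertex set of each connected component of `H` equals
that component. -/
def InConnClosure {V : Type} (H Hhat : SimpleGraph V) : Prop :=
  Minimal (fun K : SimpleGraph V =>
    K.Connected ∧ ∀ c : H.ConnectedComponent, K.induce c.supp = H.induce c.supp) Hhat

/-- If a graph `H` with at least one vertex is a minor of a connected graph
`G'`, then some graph `Ĥ` in the connection closure of `H` is a minor of `G'`. -/
theorem exists_inConnClosure_isMinor
    {V W : Type} [Finite V] [Finite W] [Nonempty W]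
    (G' : SimpleGraph V) (hG' : G'.Connected) (H : SimpleGraph W)
    (h : IsMinor H G') :
    ∃ Hhat : SimpleGraph W, InConnClosure H Hhat ∧ IsMinor Hhat G' := by
  classical
  obtain ⟨T₀, hT₀⟩ := h
  obtain ⟨T, -, hT⟩ := (Set.toFinite {T : W → Set V | (∀ v, (T v).Nonempty) ∧
    (Pairwise fun u v => Disjoint (T u) (T v)) ∧
    (∀ v, (G'.induce (T v)).Connected) ∧
    (∀ u v, H.Adj u v → ∃ u' ∈ T u, ∃ v' ∈ T v, G'.Adj u' v')}).exists_le_maximal hT₀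
  obtain ⟨⟨hne, hdis, hconn, hadj⟩, hmax⟩ := hT
  -- the branch sets cover everything
  have hcov : ∀ x, ∃ w, x ∈ T w := by
    by_contra! hx
    obtain ⟨x, hx⟩ := hx
    obtain ⟨w₀⟩ := ‹Nonempty W›
    obtain ⟨y, hy⟩ := hne w₀
    obtain ⟨p⟩ := hG'.preconnected y x
    obtain ⟨d, -, hd1, hd2⟩ := p.exists_boundary_dart {z | ∃ w, z ∈ T w} ⟨w₀, hy⟩
      (by simpa using hx)
    obtain ⟨w, hw⟩ := hd1
    have hb : ∀ u, d.snd ∉ T u := by simpa using hd2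
    have hle : T ≤ Function.update T w (insert d.snd (T w)) := by
      intro u
      by_cases huw : u = w
      · subst huw; simp
      · simp [huw]
    have := hmax (y := Function.update T w (insert d.snd (T w))) ⟨?_, ?_, ?_, ?_⟩ hle
    · have h2 := this w
      simp only [Function.update_self] at h2
      exact hb w (h2 (Set.mem_insert _ _))
    · intro v
      exact (hne v).mono (hle v)
    · intro u v huv
      by_cases hu : u = w
      · subst hu
        simp only [Function.update_self, Function.update_of_ne huv.symm]
        rw [Set.disjoint_insert_left]
        exact ⟨hb v, hdis huv⟩
      · by_cases hv : v = w
        · subst hv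
          simp only [Function.update_self, Function.update_of_ne hu]
          rw [Set.disjoint_insert_right]
          exact ⟨hb u, hdis huv⟩
        · simp only [Function.update_of_ne hu, Function.update_of_ne hv]
          exact hdis huv
    · intro v
      by_cases hv : v = w
      · subst hv
        rw [Function.update_self]
        have := connected_induce_union (t := {d.snd}) (hconn v).preconnected
          (fun a b => by rw [Subsingleton.elim a b]) hw (Set.mem_singleton d.snd) d.adj
        rwa [Set.union_singleton] at this
      · rw [Function.update_of_ne hv]
        exact hconn v
    · intro u v huv
      obtain ⟨a, ha, b, hb, hab⟩ := hadj u v huv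
      exact ⟨a, hle u ha, b, hle v hb, hab⟩
  choose f hf using hcov
  let K : SimpleGraph W :=
    { Adj := fun u v => H.Adj u v ∨
        (¬ H.Reachable u v ∧ ∃ u' ∈ T u, ∃ v' ∈ T v, G'.Adj u' v')
      symm := ⟨by
        rintro u v (h | ⟨h, a, ha, b, hb, hab⟩)
        · exact Or.inl h.symm
        · exact Or.inr ⟨fun h' => h h'.symm, b, hb, a, ha, hab.symm⟩⟩
      loopless := ⟨by
        rintro u (h | ⟨h, -⟩)
        · exact h.ne rfl
        · exact h (Reachable.refl u)⟩ }
  have hHK : H ≤ K := fun u v huv => Or.inl huv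
  have hstep : ∀ x y, G'.Adj x y → K.Reachable (f x) (f y) := by
    intro x y hxy
    by_cases hr : H.Reachable (f x) (f y)
    · exact hr.mono hHK
    · exact Adj.reachable (Or.inr ⟨hr, x, hf x, y, hf y, hxy⟩)
  have hwalk : ∀ x y, G'.Walk x y → K.Reachable (f x) (f y) := by
    intro x y p
    induction p with
    | nil => exact Reachable.refl _
    | cons hh _ ih => exact (hstep _ _ hh).trans ih
  have hfT : ∀ w x, x ∈ T w → f x = w := by
    intro w x hx
    by_contra hne'
    exact Set.disjoint_left.mp (hdis hne') (hf x) hx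
  have hKc : K.Connected := by
    refine ⟨fun u v => ?_⟩
    obtain ⟨x, hx⟩ := hne u
    obtain ⟨y, hy⟩ := hne v
    obtain ⟨p⟩ := hG'.preconnected x y
    have := hwalk x y p
    rwa [hfT u x hx, hfT v y hy] at this
  have hKi : ∀ c : H.ConnectedComponent, K.induce c.supp = H.induce c.supp := by
    intro c
    ext ⟨u, hu⟩ ⟨v, hv⟩
    have hr : H.Reachable u v := by
      rw [ConnectedComponent.mem_supp_iff] at hu hv
      exact ConnectedComponent.exact (hu.trans hv.symm)
    simp only [comap_adj, Function.Embedding.subtype_apply]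
    exact ⟨fun h => h.resolve_right fun h' => h'.1 hr, fun h => Or.inl h⟩
  obtain ⟨L, hLK, hL⟩ := (Set.toFinite {K : SimpleGraph W | K.Connected ∧
    ∀ c : H.ConnectedComponent, K.induce c.supp = H.induce c.supp}).exists_le_minimal
      (a := K) ⟨hKc, hKi⟩
  refine ⟨L, hL, T, hne, hdis, hconn, fun u v huv => ?_⟩
  rcases hLK huv with h | h
  · exact hadj u v h
  · exact h.2
end

section
/- For every natural number k there exists a first-order sentence φ_k in the language of graphs such that for every finite simple graph G: G satisfies φ_k if and only if the tree-depth of G is at most k. -/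
open SimpleGraph

/-- `TreeDepthLE V G k` says that the tree-depth of `G` is at most `k`:
the tree-depth is `0` if `G` has no vertices; for connected nonempty `G` it is
one more than the minimum over vertices `v` of the tree-depth of `G ∖ v`; and
otherwise it is the maximum of the tree-depths of the connected components. -/
inductive TreeDepthLE : ∀ (V : Type), SimpleGraph V → ℕ → Prop
  | empty (V : Type) (G : SimpleGraph V) (k : ℕ) : IsEmpty V → TreeDepthLE V G k
  | delete (V : Type) (G : SimpleGraph V) (k : ℕ) (v : V) :
      G.Connected →
      TreeDepthLE ↥({v}ᶜ : Set V) (G.induce {v}ᶜ) k → TreeDepthLE V G (k + 1)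
  | components (V : Type) (G : SimpleGraph V) (k : ℕ) :
      Nonempty V → ¬ G.Connected →
      (∀ c : G.ConnectedComponent, TreeDepthLE ↥c.supp (G.induce c.supp) k) →
      TreeDepthLE V G k

open FirstOrder

namespace TDAux

/-! ### Semantic part -/

/-- Vertices reachable from `x` by steps into `S`. -/
def C {V : Type} (G : SimpleGraph V) (S : Set V) (x : V) : Set V :=
  {y | Relation.ReflTransGen (fun a b => G.Adj a b ∧ b ∈ S) x y}

/-- Vertices reachable from `x` by at most `n` steps into `S`. -/
def B {V : Type} (G : SimpleGraph V) (S : Set V) (x : V) : ℕ → Set V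
  | 0 => {y | y = x}
  | n + 1 => {y | ∃ z, z ∈ B G S x n ∧ (y = z ∨ (G.Adj z y ∧ y ∈ S))}

/-- Tree-depth of the subgraph induced on `S` is at most `k`. -/
def P {V : Type} (G : SimpleGraph V) : ℕ → Set V → Prop
  | 0, S => ∀ x, x ∉ S
  | k + 1, S => ∀ x, x ∈ S → ∃ v, v ∈ C G S x ∧ P G k (C G S x \ {v})

/-- Bound on the diameter of components. -/
def N : ℕ → ℕ
  | 0 => 0
  | k + 1 => (N k + 1) + (1 + N k)

/-- First-order version of `P`. -/
def PFO {V : Type} (G : SimpleGraph V) : ℕ → Set V → Prop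
  | 0, S => ∀ x, x ∉ S
  | k + 1, S => ∀ x, x ∈ S →
      (∀ y, y ∈ B G S x (N (k + 1) + 1) → y ∈ B G S x (N (k + 1))) ∧
      ∃ v, v ∈ B G S x (N (k + 1)) ∧ PFO G k (B G S x (N (k + 1)) \ {v})

section
variable {V : Type} {G : SimpleGraph V} {S : Set V}

lemma B_sub_C (x : V) (n : ℕ) : B G S x n ⊆ C G S x := by
  induction n with
  | zero => rintro y rfl; exact Relation.ReflTransGen.refl
  | succ n ih =>
    rintro y ⟨z, hz, rfl | h⟩
    · exact ih hz
    · exact Relation.ReflTransGen.tail (ih hz) h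

lemma self_mem_B (x : V) (n : ℕ) : x ∈ B G S x n := by
  induction n with
  | zero => rfl
  | succ n ih => exact ⟨x, ih, Or.inl rfl⟩

lemma B_trans {x y z : V} {m n : ℕ} (h : y ∈ B G S x m) (h2 : z ∈ B G S y n) :
    z ∈ B G S x (m + n) := by
  induction n generalizing z with
  | zero => cases h2; exact h
  | succ n ih =>
    obtain ⟨w, hw, hh⟩ := h2
    exact ⟨w, ih hw, hh⟩

lemma C_sub {x y : V} (hx : x ∈ S) (h : y ∈ C G S x) : y ∈ S := by
  induction h with
  | refl => exact hx
  | tail _ h _ => exact h.2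

lemma B_one {x y : V} (h : G.Adj x y) (hy : y ∈ S) : y ∈ B G S x 1 :=
  ⟨x, rfl, Or.inr ⟨h, hy⟩⟩

lemma B_symm {x y : V} {n : ℕ} (hx : x ∈ S) (h : y ∈ B G S x n) : x ∈ B G S y n := by
  induction n generalizing y with
  | zero => cases h; rfl
  | succ n ih =>
    obtain ⟨z, hz, rfl | h⟩ := h
    · exact B_trans (ih hz) (self_mem_B _ 1)
    · rw [Nat.add_comm]
      exact B_trans (B_one h.1.symm (C_sub hx (B_sub_C _ _ hz))) (ih hz)

lemma B_mono {T : Set V} (hST : S ⊆ T) (x : V) (n : ℕ) : B G S x n ⊆ B G T x n := by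
  induction n with
  | zero => exact fun _ h => h
  | succ n ih =>
    rintro y ⟨z, hz, rfl | h⟩
    · exact ⟨y, ih hz, Or.inl rfl⟩
    · exact ⟨z, ih hz, Or.inr ⟨h.1, hST h.2⟩⟩

lemma C_symm {x y : V} (hx : x ∈ S) (h : y ∈ C G S x) : x ∈ C G S y := by
  induction h with
  | refl => exact Relation.ReflTransGen.refl
  | tail h1 h2 ih => exact Relation.ReflTransGen.head ⟨h2.1.symm, C_sub hx h1⟩ ih

lemma C_eq {x v : V} (hx : x ∈ S) (h : v ∈ C G S x) : C G S v = C G S x := by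
  ext y
  exact ⟨fun hy => Relation.ReflTransGen.trans h hy,
    fun hy => Relation.ReflTransGen.trans (C_symm hx h) hy⟩

lemma C_idem (x : V) : C G (C G S x) x ⊇ C G S x := by
  intro y hy
  induction hy with
  | refl => exact Relation.ReflTransGen.refl
  | tail h1 h2 ih => exact Relation.ReflTransGen.tail ih ⟨h2.1, Relation.ReflTransGen.tail h1 h2⟩

lemma bound_aux {v u : V} (h : u ∈ C G S v) :
    u = v ∨ ∃ w, G.Adj v w ∧ w ∈ S ∧ w ∈ C G S v \ {v} ∧ u ∈ C G (C G S v \ {v}) w := by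
  induction h with
  | refl => exact Or.inl rfl
  | @tail u u2 h1 h2 ih =>
    have hu2 : u2 ∈ C G S v := Relation.ReflTransGen.tail h1 h2
    by_cases e : u2 = v
    · exact Or.inl e
    right
    rcases ih with rfl | ⟨w, a, b, c, d⟩
    · exact ⟨u2, h2.1, h2.2, ⟨hu2, e⟩, Relation.ReflTransGen.refl⟩
    · exact ⟨w, a, b, c, Relation.ReflTransGen.tail d ⟨h2.1, hu2, e⟩⟩

lemma bound {k : ℕ} (h : P G k S) {x y : V} (hx : x ∈ S) (hy : y ∈ C G S x) :
    y ∈ B G S x (N k) := by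
  induction k generalizing S x y with
  | zero => exact absurd hx (h x)
  | succ k ih =>
    obtain ⟨v, hv, hP⟩ := h x hx
    have hvS : v ∈ S := C_sub hx hv
    have e := C_eq hx hv
    rw [← e] at hP hy
    have key : ∀ u ∈ C G S v, u ∈ B G S v (1 + N k) := by
      intro u hu
      rcases bound_aux hu with rfl | ⟨w, a, b, c, d⟩
      · exact self_mem_B _ _
      · exact B_trans (B_one a b)
          (B_mono (fun z hz => C_sub hvS hz.1) _ _ (ih hP c d))
    have h1 := B_symm hvS (key x (C_symm hx hv))
    rw [Nat.add_comm] at h1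
    exact B_trans h1 (key y hy)

lemma C_sub_B {x : V} {n : ℕ} (h : ∀ y, y ∈ B G S x (n + 1) → y ∈ B G S x n) :
    B G S x n = C G S x := by
  refine (B_sub_C _ _).antisymm ?_
  intro y hy
  induction hy with
  | refl => exact self_mem_B _ _
  | tail _ h2 ih => exact h _ ⟨_, ih, Or.inr h2⟩

lemma P_iff (k : ℕ) : P G k S ↔ PFO G k S := by
  induction k generalizing S with
  | zero => rfl
  | succ k ih =>
    constructor
    · intro h x hx
      have e : B G S x (N (k + 1)) = C G S x :=
        (B_sub_C _ _).antisymm (fun y hy => bound h hx hy)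
      obtain ⟨v, hv, hP⟩ := h x hx
      refine ⟨fun y hy => e ▸ B_sub_C _ _ hy, v, e ▸ hv, ?_⟩
      rw [e]
      exact ih.1 hP
    · intro h x hx
      obtain ⟨h1, v, hv, hP⟩ := h x hx
      rw [C_sub_B h1] at hv hP
      exact ⟨v, hv, ih.2 hP⟩

lemma C_range {W : Type} {H : SimpleGraph W} (f : G ↪g H) (a : V) :
    C H (Set.range f) (f a) = f '' {b | G.Reachable a b} := by
  ext y
  constructor
  · intro h
    induction h with
    | refl => exact ⟨a, SimpleGraph.Reachable.refl _, rfl⟩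
    | tail h1 h2 ih =>
      obtain ⟨b, hb, rfl⟩ := ih
      obtain ⟨h2, c, rfl⟩ := h2
      exact ⟨c, SimpleGraph.Reachable.trans hb (f.map_adj_iff.1 h2).reachable, rfl⟩
  · rintro ⟨b, ⟨p⟩, rfl⟩
    induction p with
    | nil => exact Relation.ReflTransGen.refl
    | cons h _ ih =>
      exact Relation.ReflTransGen.head ⟨f.map_adj_iff.2 h, Set.mem_range_self _⟩ ih

lemma C_range_conn {W : Type} {H : SimpleGraph W} (f : G ↪g H) (a : V) (hG : G.Connected) :
    C H (Set.range f) (f a) = Set.range f := by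
  rw [C_range, ← Set.image_univ]
  congr 1
  ext b
  simpa using hG.preconnected a b

/-- The inclusion of an induced subgraph followed by `f`. -/
def sub {W : Type} {H : SimpleGraph W} (f : G ↪g H) (s : Set V) : G.induce s ↪g H :=
  f.comp (SimpleGraph.Embedding.induce s)

lemma range_sub {W : Type} {H : SimpleGraph W} (f : G ↪g H) (s : Set V) :
    Set.range (sub f s) = f '' s := by
  ext y
  constructor
  · rintro ⟨⟨a, ha⟩, rfl⟩; exact ⟨a, ha, rfl⟩
  · rintro ⟨a, ha, rfl⟩; exact ⟨⟨a, ha⟩, rfl⟩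

lemma image_compl {W : Type} {H : SimpleGraph W} (f : G ↪g H) (v : V) :
    f '' {v}ᶜ = Set.range f \ {f v} := by
  rw [Set.compl_eq_univ_sdiff, Set.image_sdiff f.injective, Set.image_univ, Set.image_singleton]

lemma image_supp {W : Type} {H : SimpleGraph W} (f : G ↪g H) (a : V) :
    f '' (G.connectedComponentMk a).supp = C H (Set.range f) (f a) := by
  rw [C_range]
  congr 1
  ext b
  simp only [SimpleGraph.ConnectedComponent.mem_supp_iff, SimpleGraph.ConnectedComponent.eq,
    Set.mem_ofPred_eq]
  exact SimpleGraph.reachable_comm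

end

lemma forward {V : Type} {G : SimpleGraph V} {k : ℕ} (h : TreeDepthLE V G k) :
    ∀ (W : Type) (H : SimpleGraph W) (f : G ↪g H), P H k (Set.range f) := by
  induction h with
  | empty V G k hV =>
    intro W H f
    cases k with
    | zero => rintro x ⟨a, rfl⟩; exact hV.elim a
    | succ k => rintro x ⟨a, rfl⟩; exact hV.elim a
  | delete V G k v hG _ ih =>
    rintro W H f x ⟨a, rfl⟩
    have := ih W H (sub f _)
    rw [range_sub, image_compl] at this
    refine ⟨f v, ?_, ?_⟩
    · rw [C_range_conn f a hG]; exact Set.mem_range_self _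
    · rw [C_range_conn f a hG]; exact this
  | components V G k hV _ _ ih =>
    intro W H f
    cases k with
    | zero =>
      rintro x ⟨a, rfl⟩
      have := ih (G.connectedComponentMk a) W H (sub f _)
      rw [range_sub, image_supp] at this
      exact this (f a) Relation.ReflTransGen.refl
    | succ k =>
      rintro x ⟨a, rfl⟩
      have := ih (G.connectedComponentMk a) W H (sub f _)
      rw [range_sub, image_supp] at this
      have hs : f a ∈ C H (Set.range f) (f a) := Relation.ReflTransGen.refl
      have e : C H (C H (Set.range f) (f a)) (f a) = C H (Set.range f) (f a) :=
        Set.Subset.antisymm (fun y hy => C_sub hs hy) (C_idem _)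
      have h2 := this (f a) hs
      rwa [e] at h2

lemma backward (k : ℕ) : ∀ {V W : Type} {G : SimpleGraph V} {H : SimpleGraph W} (f : G ↪g H),
    P H k (Set.range f) → TreeDepthLE V G k := by
  induction k with
  | zero =>
    intro V W G H f h
    exact .empty _ _ _ ⟨fun a => h (f a) ⟨a, rfl⟩⟩
  | succ k ih =>
    have conn : ∀ {V W : Type} {G : SimpleGraph V} {H : SimpleGraph W} (f : G ↪g H),
        G.Connected → (∃ v ∈ Set.range f, P H k (Set.range f \ {v})) →
          TreeDepthLE V G (k + 1) := by
      rintro V W G H f hG ⟨_, ⟨v, rfl⟩, hP⟩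
      refine .delete _ _ _ v hG (ih (sub f _) ?_)
      rwa [range_sub, image_compl]
    intro V W G H f h
    by_cases hV : Nonempty V
    · by_cases hG : G.Connected
      · obtain ⟨a⟩ := hV
        have := h (f a) ⟨a, rfl⟩
        rw [C_range_conn f a hG] at this
        exact conn f hG this
      · refine .components _ _ _ hV hG ?_
        intro c
        induction c using SimpleGraph.ConnectedComponent.ind with
        | _ a =>
          refine conn (sub f _) (SimpleGraph.ConnectedComponent.connected_toSimpleGraph _) ?_
          rw [range_sub, image_supp]
          exact h (f a) ⟨a, rfl⟩
    · exact .empty _ _ _ (not_nonempty_iff.1 hV)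

lemma td_iff {V : Type} (G : SimpleGraph V) (k : ℕ) :
    TreeDepthLE V G k ↔ PFO G k Set.univ := by
  rw [← P_iff]
  have e : Set.range (SimpleGraph.Embedding.refl : G ↪g G) = Set.univ :=
    Set.range_eq_univ.2 (fun a => ⟨a, rfl⟩)
  constructor
  · intro h
    have := forward h V G SimpleGraph.Embedding.refl
    rwa [e] at this
  · intro h
    exact backward k SimpleGraph.Embedding.refl (by rwa [e])

/-! ### Definability part -/

/-- Uniformly first-order definable queries. -/
def D (α : Type) (Q : ∀ (V : Type) (_ : SimpleGraph V), (α → V) → Prop) : Prop :=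
  ∃ φ : Language.graph.Formula α, ∀ (V : Type) (G : SimpleGraph V) (v : α → V),
    (@Language.Formula.Realize Language.graph V G.structure α φ v ↔ Q V G v)

section
variable {α β : Type} {Q R : ∀ (V : Type) (_ : SimpleGraph V), (α → V) → Prop}

lemma D.not (h : D α Q) : D α (fun V G v => ¬ Q V G v) := by
  obtain ⟨φ, h⟩ := h
  refine ⟨∼φ, fun V G v => ?_⟩
  let := G.structure
  rw [Language.Formula.realize_not, h]

lemma D.and (h : D α Q) (h2 : D α R) : D α (fun V G v => Q V G v ∧ R V G v) := by
  obtain ⟨φ, h⟩ := h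
  obtain ⟨ψ, h2⟩ := h2
  refine ⟨φ ⊓ ψ, fun V G v => ?_⟩
  let := G.structure
  rw [Language.Formula.realize_inf, h, h2]

lemma D.congr (h : D α Q) (h2 : ∀ V G v, Q V G v ↔ R V G v) : D α R := by
  obtain ⟨φ, h⟩ := h
  exact ⟨φ, fun V G v => (h V G v).trans (h2 V G v)⟩

lemma D.or (h : D α Q) (h2 : D α R) : D α (fun V G v => Q V G v ∨ R V G v) :=
  (h.not.and h2.not).not.congr (fun V G v => by tauto)

lemma D.imp (h : D α Q) (h2 : D α R) : D α (fun V G v => Q V G v → R V G v) :=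
  (h.and h2.not).not.congr (fun V G v => by tauto)

lemma D.relabel (h : D α Q) (f : α → β) : D β (fun V G v => Q V G (v ∘ f)) := by
  obtain ⟨φ, h⟩ := h
  refine ⟨φ.relabel f, fun V G v => ?_⟩
  let := G.structure
  rw [Language.Formula.realize_relabel, h]

lemma D.ex {T : ∀ (V : Type) (_ : SimpleGraph V), (α → V) → V → Prop}
    (h : D (α ⊕ Unit) (fun V G v => T V G (v ∘ Sum.inl) (v (Sum.inr ())))) :
    D α (fun V G v => ∃ x, T V G v x) := by
  obtain ⟨φ, h⟩ := h
  refine ⟨φ.iExs Unit, fun V G v => ?_⟩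
  let := G.structure
  rw [Language.Formula.realize_iExs]
  constructor
  · rintro ⟨i, hi⟩
    exact ⟨i (), (h V G _).1 hi⟩
  · rintro ⟨x, hx⟩
    exact ⟨fun _ => x, (h V G _).2 hx⟩

lemma D.all {T : ∀ (V : Type) (_ : SimpleGraph V), (α → V) → V → Prop}
    (h : D (α ⊕ Unit) (fun V G v => T V G (v ∘ Sum.inl) (v (Sum.inr ())))) :
    D α (fun V G v => ∀ x, T V G v x) :=
  (D.ex (T := fun V G v x => ¬ T V G v x) h.not).not.congr (fun V G v => by simp)

lemma D.eq (a b : α) : D α (fun _ _ v => v a = v b) := by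
  refine ⟨Language.Term.equal (Language.var a) (Language.var b), fun V G v => ?_⟩
  let := G.structure
  rw [Language.Formula.realize_equal]
  rfl

lemma D.adj (a b : α) : D α (fun _ G v => G.Adj (v a) (v b)) := by
  refine ⟨Language.Relations.formula₂ Language.adj (Language.var a) (Language.var b),
    fun V G v => ?_⟩
  let := G.structure
  rw [Language.Formula.realize_rel₂]
  rfl

/-- Uniformly definable families of sets. -/
def DS (α : Type) (S : ∀ (V : Type) (_ : SimpleGraph V), (α → V) → Set V) : Prop :=
  D (α ⊕ Unit) (fun V G v => v (Sum.inr ()) ∈ S V G (v ∘ Sum.inl))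

variable {S : ∀ (V : Type) (_ : SimpleGraph V), (α → V) → Set V}

lemma DS.mem (h : DS α S) (f : α → β) (b : β) : D β (fun V G v => v b ∈ S V G (v ∘ f)) :=
  D.relabel h (Sum.elim f (fun _ => b))

lemma DS.ball (h : DS α S) (n : ℕ) : ∀ {β : Type} (f : α → β) (x y : β),
    D β (fun V G v => v y ∈ B G (S V G (v ∘ f)) (v x) n) := by
  induction n with
  | zero => intro β f x y; exact D.eq y x
  | succ n ih =>
    intro β f x y
    exact D.ex (T := fun V G v z => z ∈ B G (S V G (v ∘ f)) (v x) n ∧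
        (v y = z ∨ (G.Adj z (v y) ∧ v y ∈ S V G (v ∘ f))))
      ((ih (Sum.inl ∘ f) (Sum.inl x) (Sum.inr ())).and
        ((D.eq (Sum.inl y) (Sum.inr ())).or
          ((D.adj (Sum.inr ()) (Sum.inl y)).and (h.mem (Sum.inl ∘ f) (Sum.inl y)))))

end

lemma DS.PFO (k : ℕ) : ∀ {α : Type} {S : ∀ (V : Type) (_ : SimpleGraph V), (α → V) → Set V},
    DS α S → D α (fun V G v => PFO G k (S V G v)) := by
  induction k with
  | zero =>
    intro α S h
    exact D.all (T := fun V G v x => x ∉ S V G v) (D.not h)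
  | succ k ih =>
    intro α S h
    refine D.all (T := fun V G v x => x ∈ S V G v →
      (∀ y, y ∈ B G (S V G v) x (N (k + 1) + 1) → y ∈ B G (S V G v) x (N (k + 1))) ∧
      ∃ w, w ∈ B G (S V G v) x (N (k + 1)) ∧ TDAux.PFO G k (B G (S V G v) x (N (k + 1)) \ {w})) ?_
    refine D.imp h (D.and ?_ ?_)
    · exact D.all (T := fun V G v y =>
        y ∈ B G (S V G (v ∘ Sum.inl)) (v (Sum.inr ())) (N (k + 1) + 1) →
          y ∈ B G (S V G (v ∘ Sum.inl)) (v (Sum.inr ())) (N (k + 1)))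
        ((h.ball _ (Sum.inl ∘ Sum.inl) (Sum.inl (Sum.inr ())) (Sum.inr ())).imp
          (h.ball _ (Sum.inl ∘ Sum.inl) (Sum.inl (Sum.inr ())) (Sum.inr ())))
    · refine D.ex (T := fun V G v w =>
        w ∈ B G (S V G (v ∘ Sum.inl)) (v (Sum.inr ())) (N (k + 1)) ∧
          TDAux.PFO G k (B G (S V G (v ∘ Sum.inl)) (v (Sum.inr ())) (N (k + 1)) \ {w})) ?_
      refine (h.ball _ (Sum.inl ∘ Sum.inl) (Sum.inl (Sum.inr ())) (Sum.inr ())).and ?_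
      refine ih (S := fun V G v => B G (S V G ((v ∘ Sum.inl) ∘ Sum.inl)) (v (Sum.inl (Sum.inr ())))
        (N (k + 1)) \ {v (Sum.inr ())}) ?_
      exact (h.ball (N (k + 1)) (Sum.inl ∘ Sum.inl ∘ Sum.inl) (Sum.inl (Sum.inl (Sum.inr ())))
        (Sum.inr ())).and (D.eq (Sum.inr ()) (Sum.inl (Sum.inr ()))).not

end TDAux

/-- For every `k` there is a first-order sentence in the language of graphs
that holds in a finite simple graph `G` (viewed as a structure for the
language of graphs) if and only if the tree-depth of `G` is at most `k`. -/
theorem exists_sentence_treeDepth_le (k : ℕ) :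
    ∃ φ : Language.graph.Sentence,
      ∀ (V : Type) [Finite V] (G : SimpleGraph V),
        (@FirstOrder.Language.Sentence.Realize Language.graph V G.structure φ ↔
          TreeDepthLE V G k) := by
  have hU : TDAux.DS Empty (fun V _ _ => (Set.univ : Set V)) :=
    (TDAux.D.eq (Sum.inr ()) (Sum.inr ())).congr (fun V G v => by simp)
  obtain ⟨φ, h⟩ := TDAux.DS.PFO k hU
  refine ⟨φ, fun V _ G => ?_⟩
  rw [TDAux.td_iff]
  exact h V G _
end
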